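/- Fix a positive integer k. With probability 1 - negl(n) over G ~ G(n,1/2), for every vertex set S of size k and every family 𝔆 of nonempty subsets of S, there exists a vertex v ∉ S such that for all nonempty C ⊆ S: C ∈ 𝔆 if and only if the number of vertices adjacent to every vertex of {v} ∪ C is odd. -/

import Mathlib

open Classical

/-- Adjacency in the graph on `Fin n` encoded by `g`. -/
def GAdj {n : ℕ} (g : Fin n → Fin n → Bool) (a b : Fin n) : Prop :=
  (a < b ∧ g a b = true) ∨ (b < a ∧ g b a = true)

/-- The common-neighbor parity property: for every `k`-set `S` of vertices and every
family `𝔆` of nonempty subsets of `S`, there is `v ∉ S` such that for all nonempty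
`C ⊆ S`: `C ∈ 𝔆` iff the number of common neighbors of `{v} ∪ C` is odd. -/
def CommonParityProp (k : ℕ) {n : ℕ} (g : Fin n → Fin n → Bool) : Prop :=
  ∀ S : Finset (Fin n), S.card = k →
    ∀ F : Finset (Finset (Fin n)), (∀ C ∈ F, C ⊆ S ∧ C.Nonempty) →
      ∃ v, v ∉ S ∧ ∀ C ⊆ S, C.Nonempty →
        (C ∈ F ↔ Odd ((Finset.univ.filter (fun w : Fin n =>
          ∀ u ∈ insert v C, GAdj g w u)).card))


/-- Abstract block lemma. -/
lemma cnp_core {Ω M κ : Type*} [Fintype κ] (X0 : Finset Ω) (E : M → Ω → Prop)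
    (φ : M → Ω → Ω) (code : M → Ω → κ) (K : ℕ) (hK : Fintype.card κ ≤ K) (hK0 : 0 < K)
    (A : Finset M)
    (h1 : ∀ m ∈ A, ∀ x ∈ X0, φ m x ∈ X0)
    (h2 : ∀ m ∈ A, ∀ x ∈ X0, E m (φ m x))
    (h3 : ∀ m ∈ A, ∀ j ∈ A, j ≠ m → ∀ x ∈ X0, E j (φ m x) → E j x)
    (h4 : ∀ m ∈ A, ∀ x ∈ X0, ∀ y ∈ X0, φ m x = φ m y → code m x = code m y → x = y) :
    ((X0.filter (fun x => ∀ m ∈ A, ¬ E m x)).card : ℝ) ≤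
      (1 - 1 / (K : ℝ)) ^ A.card * (X0.card : ℝ) := by
  induction A using Finset.induction_on with
  | empty => simp
  | insert m A hm ih =>
    have ih' := ih (fun i hi => h1 i (Finset.mem_insert_of_mem hi))
      (fun i hi => h2 i (Finset.mem_insert_of_mem hi))
      (fun i hi j hj => h3 i (Finset.mem_insert_of_mem hi) j (Finset.mem_insert_of_mem hj))
      (fun i hi => h4 i (Finset.mem_insert_of_mem hi))
    have hmi := Finset.mem_insert_self m A
    set Y := X0.filter (fun x => ∀ m ∈ A, ¬ E m x) with hY
    have hsplit := Finset.card_filter_add_card_filter_not (s := Y) (fun x => E m x)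
    have heq : X0.filter (fun x => ∀ i ∈ insert m A, ¬ E i x) = Y.filter (fun x => ¬ E m x) := by
      ext x
      simp only [hY, Finset.mem_filter, Finset.mem_insert, forall_eq_or_imp]
      tauto
    have hle : Y.card ≤ (Y.filter (fun x => E m x)).card * K := by
      calc Y.card ≤ ((Y.filter (fun x => E m x)) ×ˢ (Finset.univ : Finset κ)).card := by
            apply Finset.card_le_card_of_injOn (fun x => (φ m x, code m x))
            · intro x hx
              simp only [hY, Finset.coe_filter, Set.mem_ofPred_eq] at hx
              simp only [hY, Finset.coe_product, Set.mem_prod, Finset.mem_coe, Finset.mem_filter,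
                Finset.mem_univ, and_true]
              refine ⟨⟨h1 m hmi x hx.1, ?_⟩, h2 m hmi x hx.1⟩
              intro j hj hE
              exact hx.2 j hj (h3 m hmi j (Finset.mem_insert_of_mem hj)
                (fun h => hm (h ▸ hj)) x hx.1 hE)
            · intro x hx y hy hxy
              simp only [hY, Finset.coe_filter, Set.mem_ofPred_eq] at hx hy
              simp only [Prod.mk.injEq] at hxy
              exact h4 m hmi x hx.1 y hy.1 hxy.1 hxy.2
        _ ≤ _ := by
            rw [Finset.card_product, Finset.card_univ]
            exact Nat.mul_le_mul_left _ hK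
    rw [heq, Finset.card_insert_of_notMem hm, pow_succ]
    have hKr : (0 : ℝ) < K := by exact_mod_cast hK0
    have hK1 : (1 : ℝ) ≤ K := by exact_mod_cast hK0
    have hle' : (Y.card : ℝ) ≤ ((Y.filter (fun x => E m x)).card : ℝ) * K := by exact_mod_cast hle
    have hs' : ((Y.filter (fun x => E m x)).card : ℝ) + ((Y.filter (fun x => ¬ E m x)).card : ℝ)
      = Y.card := by exact_mod_cast hsplit
    have hq : (0 : ℝ) ≤ 1 - 1 / (K : ℝ) := by
      rw [sub_nonneg, div_le_one hKr]; exact hK1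
    have hd : (Y.card : ℝ) / K ≤ ((Y.filter (fun x => E m x)).card : ℝ) := by
      rw [div_le_iff₀ hKr]; exact hle'
    calc ((Y.filter (fun x => ¬ E m x)).card : ℝ) ≤ (1 - 1 / (K : ℝ)) * Y.card := by
          have : (1 - 1 / (K : ℝ)) * Y.card = Y.card - Y.card / K := by ring
          rw [this]; linarith
      _ ≤ (1 - 1 / (K : ℝ)) * ((1 - 1 / (K : ℝ)) ^ A.card * (X0.card : ℝ)) :=
          mul_le_mul_of_nonneg_left ih' hq
      _ = _ := by ring

/-- Reset the edges from `w` to `D` so that they are exactly those to `P`. -/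
noncomputable def cnpUpd {n : ℕ} (g : Fin n → Fin n → Bool) (w : Fin n) (D P : Finset (Fin n)) :
    Fin n → Fin n → Bool :=
  fun a b => if a = w ∧ b ∈ D ∧ a < b then decide (b ∈ P)
    else if b = w ∧ a ∈ D ∧ a < b then decide (a ∈ P) else g a b

lemma cnp_symm {n : ℕ} (g : Fin n → Fin n → Bool) (a b : Fin n) : GAdj g a b ↔ GAdj g b a := by
  unfold GAdj; tauto

lemma cnp_irrefl {n : ℕ} (g : Fin n → Fin n → Bool) (a : Fin n) : ¬ GAdj g a a := by
  simp [GAdj]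

lemma cnpUpd_same {n : ℕ} (g : Fin n → Fin n → Bool) (w : Fin n) (D P : Finset (Fin n))
    (x u : Fin n) (hu : u ≠ w) (hD : u ∉ D) : GAdj (cnpUpd g w D P) x u ↔ GAdj g x u := by
  unfold GAdj cnpUpd
  simp [hu, hD]

lemma cnpUpd_same2 {n : ℕ} (g : Fin n → Fin n → Bool) (w : Fin n) (D P : Finset (Fin n))
    (x u : Fin n) (hu : u ≠ w) (hx : x ≠ w) : GAdj (cnpUpd g w D P) x u ↔ GAdj g x u := by
  unfold GAdj cnpUpd
  simp [hu, hx]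

lemma cnpUpd_same3 {n : ℕ} (g : Fin n → Fin n → Bool) (w : Fin n) (D P : Finset (Fin n))
    (x u : Fin n) (hu : u ∉ D) (hx : x ∉ D) : GAdj (cnpUpd g w D P) x u ↔ GAdj g x u := by
  unfold GAdj cnpUpd
  simp [hu, hx]

lemma cnpUpd_new {n : ℕ} (g : Fin n → Fin n → Bool) (w : Fin n) (D P : Finset (Fin n))
    (u : Fin n) (hu : u ≠ w) (hD : u ∈ D) : GAdj (cnpUpd g w D P) w u ↔ u ∈ P := by
  unfold GAdj cnpUpd
  rcases lt_or_gt_of_ne hu with h | h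
  · simp [hu, hD, h, not_lt_of_gt h]
  · simp [hD, h, not_lt_of_gt h]

lemma cnpUpd_inj {n : ℕ} (g g' : Fin n → Fin n → Bool) (w : Fin n) (D P P' : Finset (Fin n))
    (h : cnpUpd g w D P = cnpUpd g' w D P')
    (hc : ∀ u ∈ D, (GAdj g w u ↔ GAdj g' w u)) : g = g' := by
  funext a b
  have hab := congrFun (congrFun h a) b
  unfold cnpUpd at hab
  by_cases h1 : a = w ∧ b ∈ D ∧ a < b
  · obtain ⟨rfl, hb, hlt⟩ := h1
    have := hc b hb
    simp only [GAdj, hlt, not_lt_of_gt hlt, true_and, false_and, or_false] at this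
    exact Bool.eq_iff_iff.mpr this
  · by_cases h2 : b = w ∧ a ∈ D ∧ a < b
    · obtain ⟨rfl, hb, hlt⟩ := h2
      have := hc a hb
      simp only [GAdj, hlt, not_lt_of_gt hlt, true_and, false_and, false_or] at this
      exact Bool.eq_iff_iff.mpr this
    · rw [if_neg h1, if_neg h2, if_neg h1, if_neg h2] at hab
      exact hab

/-- Moebius inversion modulo 2. -/
lemma cnp_moebius {α : Type*} (S : Finset α) (f : Finset α → ZMod 2) :
    ∃ a : Finset α → ZMod 2, ∀ C ⊆ S, ∑ T ∈ S.powerset with C ⊆ T, a T = f C := by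
  refine ⟨fun T => ∑ U ∈ S.powerset with T ⊆ U, f U, fun C hC => ?_⟩
  rw [Finset.sum_comm' (t' := S.powerset.filter (fun U => C ⊆ U)) (s' := fun U => Finset.Icc C U)]
  · rw [Finset.sum_eq_single C]
    · simp
    · intro U hU hne
      simp only [Finset.mem_filter, Finset.mem_powerset] at hU
      rw [Finset.sum_const, Finset.card_Icc_finset hU.2]
      have hlt : C.card < U.card := Finset.card_lt_card (hU.2.ssubset_of_ne (Ne.symm hne))
      obtain ⟨d, hd⟩ : ∃ d, U.card - C.card = d + 1 := ⟨U.card - C.card - 1, by omega⟩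
      rw [hd, pow_succ, mul_smul, nsmul_eq_mul, nsmul_eq_mul]
      have : ((2 : ℕ) : ZMod 2) = 0 := by decide
      rw [this]; simp
    · intro h; simp [hC] at h
  · intro T U
    simp only [Finset.mem_filter, Finset.mem_powerset, Finset.mem_Icc]
    constructor
    · rintro ⟨⟨h1, h2⟩, h3, h4⟩; exact ⟨⟨h2, h4⟩, h3, h2.trans h4⟩
    · rintro ⟨⟨h1, h2⟩, h3, h4⟩; exact ⟨⟨h2.trans h3, h1⟩, h3, h2⟩

/-- `v` realizes the family `F` over `S`. -/
def cnpGood {n : ℕ} (S : Finset (Fin n)) (F : Finset (Finset (Fin n)))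
    (v : Fin n) (g : Fin n → Fin n → Bool) : Prop :=
  ∀ C ⊆ S, C.Nonempty →
        (C ∈ F ↔ Odd ((Finset.univ.filter (fun w : Fin n =>
          ∀ u ∈ insert v C, GAdj g w u)).card))

/-- `w` has type exactly `T` over `S`. -/
def cnpType {n : ℕ} (S T : Finset (Fin n)) (w : Fin n) (g : Fin n → Fin n → Bool) : Prop :=
  ∀ u ∈ S, (GAdj g w u ↔ u ∈ T)

lemma cnp_phase1 {n : ℕ} (S T B : Finset (Fin n)) (hB : Disjoint B S) :
    ((Finset.univ.filter (fun g : Fin n → Fin n → Bool => ∀ w ∈ B, ¬ cnpType S T w g)).card : ℝ)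
      ≤ (1 - 1 / ((2 ^ S.card : ℕ) : ℝ)) ^ B.card *
        ((Finset.univ : Finset (Fin n → Fin n → Bool)).card : ℝ) := by
  have hBS : ∀ w ∈ B, w ∉ S := fun w hw => Finset.disjoint_left.mp hB hw
  refine le_trans (le_of_eq (by congr)) (cnp_core (κ := (S → Prop)) Finset.univ (fun w g => cnpType S T w g)
    (fun w g => cnpUpd g w S T) (fun w g u => GAdj g w u) (2 ^ S.card) (by simp) (by positivity) B
    ?_ ?_ ?_ ?_)
  · intros; simp
  · intro w hw g _ u hu
    exact cnpUpd_new g w S T u (fun h => hBS w hw (h ▸ hu)) hu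
  · intro w hw j hj hne g _ hE u hu
    rw [← hE u hu, cnpUpd_same2 g w S T j u (fun h => hBS w hw (h ▸ hu)) hne]
  · intro w hw g _ g' _ h hc
    refine cnpUpd_inj g g' w S T T h (fun u hu => ?_)
    exact iff_of_eq (congrFun hc ⟨u, hu⟩)

lemma cnp_solve {n : ℕ} (S : Finset (Fin n)) (F : Finset (Finset (Fin n))) (v : Fin n)
    (hv : v ∉ S) (g : Fin n → Fin n → Bool) (s : Finset (Fin n) → Fin n)
    (hs : ∀ T ⊆ S, cnpType S T (s T) g) (hsS : ∀ T ⊆ S, s T ∉ S) (hsv : ∀ T ⊆ S, s T ≠ v) :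
    ∃ P, cnpGood S F v (cnpUpd g v (S.powerset.image s) P) := by
  have hinj : Set.InjOn s (S.powerset : Set (Finset (Fin n))) := by
    intro T hT T' hT' h
    simp only [Finset.coe_powerset, Set.mem_preimage, Set.mem_powerset_iff, Finset.coe_subset]
      at hT hT'
    ext u
    constructor
    · intro hu; rw [← hs T' hT' u (hT hu), ← h, hs T hT u (hT hu)]; exact hu
    · intro hu; rw [← hs T hT u (hT' hu), h, hs T' hT' u (hT' hu)]; exact hu
  set D := S.powerset.image s with hD
  have hvD : v ∉ D := by
    simp only [hD, Finset.mem_image, Finset.mem_powerset, not_exists, not_and]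
    exact hsv
  have hDS : ∀ u ∈ S, u ∉ D := by
    intro u hu
    simp only [hD, Finset.mem_image, Finset.mem_powerset, not_exists, not_and]
    intro T hT h
    exact hsS T hT (h ▸ hu)
  obtain ⟨a, ha⟩ := cnp_moebius S (fun C => (if C ∈ F then (1 : ZMod 2) else 0) -
    ∑ w ∈ Finset.univ.filter (fun w => w ∉ D), if (∀ u ∈ insert v C, GAdj g w u) then 1 else 0)
  refine ⟨(S.powerset.filter (fun T => a T = 1)).image s, ?_⟩
  set P := (S.powerset.filter (fun T => a T = 1)).image s with hP
  intro C hC hne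
  have hmemP : ∀ T ⊆ S, (s T ∈ P ↔ a T = 1) := by
    intro T hT
    simp only [hP, Finset.mem_image, Finset.mem_filter, Finset.mem_powerset]
    constructor
    · rintro ⟨T', ⟨h1, h2⟩, h3⟩
      rw [← hinj (by simpa using h1) (by simpa using hT) h3]; exact h2
    · intro h; exact ⟨T, ⟨hT, h⟩, rfl⟩
  have key : (((Finset.univ.filter (fun w : Fin n =>
          ∀ u ∈ insert v C, GAdj (cnpUpd g v D P) w u)).card : ℕ) : ZMod 2)
        = if C ∈ F then 1 else 0 := by
    rw [Finset.card_filter]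
    push_cast
    rw [← Finset.sum_filter_add_sum_filter_not Finset.univ (fun w => w ∈ D)]
    have e1 : ∑ w ∈ Finset.univ.filter (fun w => w ∉ D),
        (if (∀ u ∈ insert v C, GAdj (cnpUpd g v D P) w u) then (1 : ZMod 2) else 0)
        = ∑ w ∈ Finset.univ.filter (fun w => w ∉ D),
        if (∀ u ∈ insert v C, GAdj g w u) then (1 : ZMod 2) else 0 := by
      apply Finset.sum_congr rfl
      intro w hw
      simp only [Finset.mem_filter, Finset.mem_univ, true_and] at hw
      congr 1
      apply propext
      apply forall₂_congr
      intro u hu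
      apply cnpUpd_same3 _ _ _ _ _ _ _ hw
      rcases Finset.mem_insert.mp hu with rfl | hu
      · exact hvD
      · exact hDS u (hC hu)
    have e2 : ∑ w ∈ Finset.univ.filter (fun w => w ∈ D),
        (if (∀ u ∈ insert v C, GAdj (cnpUpd g v D P) w u) then (1 : ZMod 2) else 0)
        = ∑ T ∈ S.powerset with C ⊆ T, a T := by
      have : Finset.univ.filter (fun w => w ∈ D) = D := by ext; simp
      rw [this, hD, Finset.sum_image hinj, Finset.sum_filter]
      apply Finset.sum_congr rfl
      intro T hT
      rw [← hD]
      rw [Finset.mem_powerset] at hT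
      have hcond : (∀ u ∈ insert v C, GAdj (cnpUpd g v D P) (s T) u) ↔ (a T = 1 ∧ C ⊆ T) := by
        rw [Finset.forall_mem_insert]
        apply and_congr
        · rw [cnp_symm, cnpUpd_new _ _ _ _ _ (hsv T hT)
            (Finset.mem_image_of_mem s (Finset.mem_powerset.mpr hT)), hmemP T hT]
        · apply forall₂_congr
          intro u hu
          have hne' : u ≠ v := fun h => hv (h ▸ hC hu)
          rw [cnpUpd_same _ _ _ _ _ _ hne' (hDS u (hC hu))]
          exact hs T hT u (hC hu)
      have h01 : ∀ z : ZMod 2, z = 0 ∨ z = 1 := by decide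
      simp only [hcond]
      by_cases hCT : C ⊆ T
      · rcases h01 (a T) with h | h <;> simp [h, hCT]
      · simp [hCT]
    have e3 := ha C hC
    rw [e1, e2]
    refine Eq.trans (congrArg₂ (· + ·) (Eq.trans ?_ e3) rfl) (sub_add_cancel _ _)
    congr
  rw [← ZMod.natCast_eq_one_iff_odd, key]
  by_cases h : C ∈ F <;> simp [h]

lemma cnp_phase2 {n : ℕ} (S A B : Finset (Fin n)) (F : Finset (Finset (Fin n)))
    (hB : Disjoint B S) (hA : Disjoint A S) (hAB : Disjoint A B) :
    (((Finset.univ.filter (fun g : Fin n → Fin n → Bool =>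
        ∀ T ⊆ S, ∃ w ∈ B, cnpType S T w g)).filter (fun g => ∀ v ∈ A, ¬ cnpGood S F v g)).card : ℝ)
      ≤ (1 - 1 / ((2 ^ 2 ^ S.card : ℕ) : ℝ)) ^ A.card *
        ((Finset.univ.filter (fun g : Fin n → Fin n → Bool =>
        ∀ T ⊆ S, ∃ w ∈ B, cnpType S T w g)).card : ℝ) := by
  rcases isEmpty_or_nonempty (Fin n) with hn | hn
  · have : A = ∅ := Finset.eq_empty_of_isEmpty A
    subst this
    simp
  have hBS : ∀ w ∈ B, w ∉ S := fun w hw => Finset.disjoint_left.mp hB hw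
  have hAS : ∀ w ∈ A, w ∉ S := fun w hw => Finset.disjoint_left.mp hA hw
  have hAB' : ∀ w ∈ A, w ∉ B := fun w hw => Finset.disjoint_left.mp hAB hw
  set X0 := Finset.univ.filter (fun g : Fin n → Fin n → Bool =>
        ∀ T ⊆ S, ∃ w ∈ B, cnpType S T w g) with hX0
  let s : (Fin n → Fin n → Bool) → Finset (Fin n) → Fin n :=
    fun g T => Classical.epsilon (fun w => w ∈ B ∧ cnpType S T w g)
  have hs : ∀ g ∈ X0, ∀ T ⊆ S, s g T ∈ B ∧ cnpType S T (s g T) g := by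
    intro g hg T hT
    simp only [hX0, Finset.mem_filter, Finset.mem_univ, true_and] at hg
    exact Classical.epsilon_spec (hg T hT)
  have hex : ∀ (v : Fin n) (g : Fin n → Fin n → Bool), ∃ P, v ∈ A → g ∈ X0 →
      cnpGood S F v (cnpUpd g v (S.powerset.image (s g)) P) := by
    intro v g
    by_cases h : v ∈ A ∧ g ∈ X0
    · obtain ⟨P, hP⟩ := cnp_solve S F v (hAS v h.1) g (s g) (fun T hT => (hs g h.2 T hT).2)
        (fun T hT => hBS _ (hs g h.2 T hT).1)
        (fun T hT he => hAB' v h.1 (he ▸ (hs g h.2 T hT).1))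
      exact ⟨P, fun _ _ => hP⟩
    · exact ⟨∅, fun h1 h2 => absurd ⟨h1, h2⟩ h⟩
  choose P hP using hex
  have hDB : ∀ g ∈ X0, ∀ u ∈ S.powerset.image (s g), u ∈ B := by
    intro g hg u hu
    obtain ⟨T, hT, rfl⟩ := Finset.mem_image.mp hu
    exact (hs g hg T (Finset.mem_powerset.mp hT)).1
  have htype : ∀ v ∈ A, ∀ g ∈ X0, ∀ T w,
      cnpType S T w (cnpUpd g v (S.powerset.image (s g)) (P v g)) ↔ cnpType S T w g := by
    intro v hv g hg T w
    apply forall₂_congr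
    intro u hu
    have hne : u ≠ v := fun h => hAS v hv (h ▸ hu)
    rw [cnpUpd_same _ _ _ _ _ _ hne
      (fun h => hBS u (hDB g hg u h) hu)]
  have hsel : ∀ v ∈ A, ∀ g ∈ X0,
      s (cnpUpd g v (S.powerset.image (s g)) (P v g)) = s g := by
    intro v hv g hg
    funext T
    simp only [s, htype v hv g hg]
  refine le_trans (le_of_eq (by congr)) (cnp_core (κ := (S.powerset → Prop)) X0 (fun v g => cnpGood S F v g)
    (fun v g => cnpUpd g v (S.powerset.image (s g)) (P v g))
    (fun v g T => GAdj g v (s g T)) (2 ^ 2 ^ S.card)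
    (by rw [Fintype.card_fun, Fintype.card_coe, Finset.card_powerset]; simp) (by positivity) A
    ?_ ?_ ?_ ?_)
  · intro v hv g hg
    have hg' := hg
    simp only [hX0, Finset.mem_filter, Finset.mem_univ, true_and] at hg' ⊢
    intro T hT
    obtain ⟨w, hw, hw'⟩ := hg' T hT
    exact ⟨w, hw, (htype v hv g hg T w).mpr hw'⟩
  · intro v hv g hg
    exact hP v g hv hg
  · intro v hv j hj hne g hg hE C hC hCn
    rw [hE C hC hCn]
    have : ∀ w, (∀ u ∈ insert j C,
        GAdj (cnpUpd g v (S.powerset.image (s g)) (P v g)) w u) ↔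
        (∀ u ∈ insert j C, GAdj g w u) := by
      intro w
      apply forall₂_congr
      intro u hu
      rcases Finset.mem_insert.mp hu with rfl | hu
      · exact cnpUpd_same _ _ _ _ _ _ hne (fun h => hAB' u hj (hDB g hg u h))
      · exact cnpUpd_same _ _ _ _ _ _ (fun h => hAS v hv (h ▸ hC hu))
          (fun h => hBS u (hDB g hg u h) (hC hu))
    simp only [this]
  · intro v hv g hg g' hg' h hc
    have hss : s g = s g' := by
      rw [← hsel v hv g hg, ← hsel v hv g' hg']
      exact congrArg s h
    rw [← hss] at h
    refine cnpUpd_inj g g' v _ _ _ h (fun u hu => ?_)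
    obtain ⟨T, hT, rfl⟩ := Finset.mem_image.mp hu
    have := congrFun hc ⟨T, hT⟩
    rw [← hss] at this
    exact iff_of_eq this

lemma cnp_single {n k m : ℕ} (S : Finset (Fin n)) (F : Finset (Finset (Fin n)))
    (hS : S.card = k) (hm : 2 * m + k ≤ n) :
    ((Finset.univ.filter (fun g : Fin n → Fin n → Bool =>
        ∀ v, v ∉ S → ¬ cnpGood S F v g)).card : ℝ)
      ≤ (2 ^ k + 1) * (1 - 1 / ((2 ^ 2 ^ k : ℕ) : ℝ)) ^ m *
        (Fintype.card (Fin n → Fin n → Bool) : ℝ) := by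
  have hc : Sᶜ.card = n - k := by rw [Finset.card_compl, hS, Fintype.card_fin]
  obtain ⟨A, hAS, hAc⟩ := Finset.exists_subset_card_eq (s := Sᶜ) (n := m) (by omega)
  obtain ⟨B, hBS, hBc⟩ := Finset.exists_subset_card_eq (s := Sᶜ \ A) (n := m)
    (by rw [Finset.card_sdiff_of_subset hAS]; omega)
  have hA : Disjoint A S := Finset.disjoint_left.mpr fun x hx =>
    Finset.mem_compl.mp (hAS hx)
  have hB : Disjoint B S := Finset.disjoint_left.mpr fun x hx =>
    Finset.mem_compl.mp (Finset.mem_sdiff.mp (hBS hx)).1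
  have hAB : Disjoint A B := Finset.disjoint_right.mpr fun x hx =>
    (Finset.mem_sdiff.mp (hBS hx)).2
  have p1 := fun T => cnp_phase1 S T B hB
  have p2 := cnp_phase2 S A B F hB hA hAB
  set N : ℝ := (Fintype.card (Fin n → Fin n → Bool) : ℝ) with hN
  set q : ℝ := 1 - 1 / ((2 ^ 2 ^ k : ℕ) : ℝ) with hq
  have hN0 : 0 ≤ N := by positivity
  have hq0 : 0 ≤ q := by
    rw [hq, sub_nonneg, div_le_one (by positivity)]
    exact_mod_cast Nat.one_le_two_pow
  have hq1 : (1 - 1 / ((2 ^ k : ℕ) : ℝ)) ≤ q := by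
    rw [hq]
    apply sub_le_sub_left
    apply one_div_le_one_div_of_le (by positivity)
    exact_mod_cast Nat.pow_le_pow_right (by norm_num) (Nat.lt_two_pow_self).le
  have hq2 : 0 ≤ (1 - 1 / ((2 ^ k : ℕ) : ℝ)) := by
    rw [sub_nonneg, div_le_one (by positivity)]
    exact_mod_cast Nat.one_le_two_pow
  have hsub : (Finset.univ.filter (fun g : Fin n → Fin n → Bool =>
        ∀ v, v ∉ S → ¬ cnpGood S F v g)) ⊆
      (S.powerset.biUnion (fun T => Finset.univ.filter
        (fun g : Fin n → Fin n → Bool => ∀ w ∈ B, ¬ cnpType S T w g))) ∪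
      ((Finset.univ.filter (fun g : Fin n → Fin n → Bool =>
        ∀ T ⊆ S, ∃ w ∈ B, cnpType S T w g)).filter (fun g => ∀ v ∈ A, ¬ cnpGood S F v g)) := by
    intro g hg
    simp only [Finset.mem_filter, Finset.mem_univ, true_and, Finset.mem_union, Finset.mem_biUnion,
      Finset.mem_powerset] at hg ⊢
    by_cases h : ∀ T ⊆ S, ∃ w ∈ B, cnpType S T w g
    · exact Or.inr ⟨h, fun v hv => hg v (Finset.disjoint_left.mp hA hv)⟩
    · left
      push Not at h
      exact h
  have hcard := (Finset.card_le_card hsub).trans (Finset.card_union_le _ _)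
  have hcard2 := hcard.trans (Nat.add_le_add_right Finset.card_biUnion_le _)
  have hcard3 : ((Finset.univ.filter (fun g : Fin n → Fin n → Bool =>
        ∀ v, v ∉ S → ¬ cnpGood S F v g)).card : ℝ) ≤ _ := Nat.cast_le.mpr hcard2
  refine hcard3.trans ?_
  push_cast
  have b1 : ∑ T ∈ S.powerset, ((Finset.univ.filter
        (fun g : Fin n → Fin n → Bool => ∀ w ∈ B, ¬ cnpType S T w g)).card : ℝ)
      ≤ 2 ^ k * (q ^ m * N) := by
    calc _ ≤ ∑ T ∈ S.powerset, q ^ m * N := by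
          apply Finset.sum_le_sum
          intro T _
          refine (p1 T).trans ?_
          rw [hS, hBc, Finset.card_univ]
          exact mul_le_mul_of_nonneg_right (pow_le_pow_left₀ hq2 hq1 m) hN0
      _ = _ := by
          rw [Finset.sum_const, Finset.card_powerset, hS, nsmul_eq_mul]
          push_cast; ring
  have b2 := p2.trans (b := _) (c := q ^ m * N) (by
    rw [hS, hAc]
    apply mul_le_mul_of_nonneg_left _ (pow_nonneg hq0 m)
    exact Nat.cast_le.mpr (Finset.card_le_univ _))
  calc _ ≤ 2 ^ k * (q ^ m * N) + q ^ m * N := add_le_add b1 b2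
    _ = _ := by ring

lemma cnp_total {n k m : ℕ} (hm : 2 * m + k ≤ n) :
    ((Finset.univ.filter
          (fun g : Fin n → Fin n → Bool => ¬ CommonParityProp k g)).card : ℝ)
      ≤ (n : ℝ) ^ k * (2 ^ 2 ^ k * ((2 ^ k + 1) * (1 - 1 / ((2 ^ 2 ^ k : ℕ) : ℝ)) ^ m *
        (Fintype.card (Fin n → Fin n → Bool) : ℝ))) := by
  have hsub : (Finset.univ.filter
          (fun g : Fin n → Fin n → Bool => ¬ CommonParityProp k g)) ⊆
      (Finset.powersetCard k (Finset.univ : Finset (Fin n))).biUnion (fun S =>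
        S.powerset.powerset.biUnion (fun F => Finset.univ.filter
          (fun g : Fin n → Fin n → Bool => ∀ v, v ∉ S → ¬ cnpGood S F v g))) := by
    intro g hg
    simp only [Finset.mem_filter, Finset.mem_univ, true_and, Finset.mem_biUnion,
      Finset.mem_powerset, Finset.mem_powersetCard, Finset.subset_univ] at hg ⊢
    unfold CommonParityProp at hg
    push Not at hg
    obtain ⟨S, hS, F, hF, h⟩ := hg
    refine ⟨S, hS, F, fun C hC => Finset.mem_powerset.mpr (hF C hC).1, fun v hv hgood => ?_⟩
    obtain ⟨C, hC, hCn, hno⟩ := h v hv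
    have := hgood C hC hCn
    tauto
  have h1 := (Finset.card_le_card hsub).trans Finset.card_biUnion_le
  have h2 := h1.trans (Finset.sum_le_sum fun S _ => Finset.card_biUnion_le)
  have h3 : ((Finset.univ.filter
          (fun g : Fin n → Fin n → Bool => ¬ CommonParityProp k g)).card : ℝ) ≤ _ :=
    Nat.cast_le.mpr h2
  refine h3.trans ?_
  simp only [Nat.cast_sum]
  set Z : ℝ := (2 ^ k + 1) * (1 - 1 / ((2 ^ 2 ^ k : ℕ) : ℝ)) ^ m *
        (Fintype.card (Fin n → Fin n → Bool) : ℝ) with hZ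
  have hZ0 : 0 ≤ Z := by
    have hq0 : (0 : ℝ) ≤ 1 - 1 / ((2 ^ 2 ^ k : ℕ) : ℝ) := by
      rw [sub_nonneg, div_le_one (by positivity)]
      exact_mod_cast Nat.one_le_two_pow
    have := pow_nonneg hq0 m
    positivity
  calc _ ≤ ∑ S ∈ Finset.powersetCard k (Finset.univ : Finset (Fin n)), (2 ^ 2 ^ k * Z) := by
        apply Finset.sum_le_sum
        intro S hS
        have hS' := (Finset.mem_powersetCard.mp hS).2
        calc _ ≤ ∑ F ∈ S.powerset.powerset, Z :=
              Finset.sum_le_sum fun F _ => cnp_single S F hS' hm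
          _ = _ := by
              rw [Finset.sum_const, Finset.card_powerset, Finset.card_powerset, hS', nsmul_eq_mul]
              push_cast; ring
    _ = (n.choose k : ℝ) * (2 ^ 2 ^ k * Z) := by
        rw [Finset.sum_const, Finset.card_powersetCard, nsmul_eq_mul, Finset.card_univ,
          Fintype.card_fin]
    _ ≤ _ := by
        apply mul_le_mul_of_nonneg_right _ (by positivity)
        exact_mod_cast Nat.choose_le_pow n k

/-- For fixed `k ≥ 1`, with probability `1 - negl(n)` over `G ~ G(n,1/2)`, the
common-neighbor parity property holds for all `S` of size `k` and all families `𝔆`. -/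
theorem common_neighbor_parity_whp (k : ℕ) (hk : 0 < k) :
    ∀ c : ℕ, ∃ N : ℕ, ∀ n ≥ N,
      ((Finset.univ.filter
          (fun g : Fin n → Fin n → Bool => ¬ CommonParityProp k g)).card : ℝ) /
        (Fintype.card (Fin n → Fin n → Bool) : ℝ) ≤ 1 / (n : ℝ) ^ c := by
  intro c
  set q : ℝ := 1 - 1 / ((2 ^ 2 ^ k : ℕ) : ℝ) with hq
  have hq0 : 0 ≤ q := by
    rw [hq, sub_nonneg, div_le_one (by positivity)]
    exact_mod_cast Nat.one_le_two_pow
  have hq1 : q < 1 := by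
    rw [hq]
    have : (0 : ℝ) < 1 / ((2 ^ 2 ^ k : ℕ) : ℝ) := by positivity
    linarith
  have hlim := (tendsto_pow_const_mul_const_pow_of_abs_lt_one (k + c)
    (r := q) (by rw [abs_of_nonneg hq0]; exact hq1)).const_mul
    ((k + 3 : ℝ) ^ (k + c) * (2 ^ 2 ^ k * (2 ^ k + 1)))
  rw [mul_zero] at hlim
  obtain ⟨M, hM⟩ := Filter.eventually_atTop.mp (hlim.eventually (ge_mem_nhds one_pos))
  refine ⟨2 * (M + 1) + k, fun n hn => ?_⟩
  obtain ⟨m, hm⟩ : ∃ m, m = (n - k) / 2 := ⟨_, rfl⟩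
  have hmM : M ≤ m := by omega
  have hm1 : 1 ≤ m := by omega
  have hmn : 2 * m + k ≤ n := by omega
  have hnm : n ≤ (k + 3) * m := by
    have : n ≤ 2 * m + k + 1 := by omega
    nlinarith
  have hb := hM m hmM
  have ht := cnp_total (n := n) (k := k) (m := m) hmn
  rw [← hq] at ht
  have hNpos : (0 : ℝ) < (Fintype.card (Fin n → Fin n → Bool) : ℝ) := by
    exact_mod_cast Fintype.card_pos
  have hn0 : (0 : ℝ) < (n : ℝ) := by
    have : 0 < n := by omega
    exact_mod_cast this
  rw [div_le_div_iff₀ hNpos (by positivity)]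
  have hnm' : (n : ℝ) ≤ (k + 3) * m := by exact_mod_cast hnm
  have hpow : (n : ℝ) ^ (k + c) ≤ (k + 3 : ℝ) ^ (k + c) * (m : ℝ) ^ (k + c) := by
    rw [← mul_pow]
    exact pow_le_pow_left₀ hn0.le hnm' _
  have hqm := pow_nonneg hq0 m
  set N : ℝ := (Fintype.card (Fin n → Fin n → Bool) : ℝ)
  calc _ ≤ ((n : ℝ) ^ k * (2 ^ 2 ^ k * ((2 ^ k + 1) * q ^ m * N))) * (n : ℝ) ^ c :=
        mul_le_mul_of_nonneg_right ht (by positivity)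
    _ = (n : ℝ) ^ (k + c) * ((2 ^ 2 ^ k * (2 ^ k + 1)) * q ^ m * N) := by
        rw [pow_add]; ring
    _ ≤ ((k + 3 : ℝ) ^ (k + c) * (m : ℝ) ^ (k + c)) * ((2 ^ 2 ^ k * (2 ^ k + 1)) * q ^ m * N) :=
        mul_le_mul_of_nonneg_right hpow (by positivity)
    _ = ((k + 3 : ℝ) ^ (k + c) * (2 ^ 2 ^ k * (2 ^ k + 1)) * ((m : ℝ) ^ (k + c) * q ^ m)) * N := by
        ring
    _ ≤ 1 * N := mul_le_mul_of_nonneg_right hb hNpos.le
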